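/- Let C be a binary linear code of length n and let z be a nonzero codeword of C. Then the following are equivalent: (1) X(D(0)) ∩ D(z) ≠ ∅, where X(D(0)) is the set of words at Hamming distance exactly 1 from the set D(0) of coset leaders and D(z) is the Voronoi region of z; (2) z is a leader codeword, i.e. z ∈ L(C). -/

import Mathlib

/-- `w` is a coset leader of the binary code `C`: it has minimal Hamming weight
in its coset `w + C`. -/
def IsCosetLeader {n : ℕ} (C : Submodule (ZMod 2) (Fin n → ZMod 2))
    (w : Fin n → ZMod 2) : Prop :=
  ∀ v : Fin n → ZMod 2, w - v ∈ C → hammingNorm w ≤ hammingNorm v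

/-- The set of leader codewords of `C`. -/
def leaderCodewords {n : ℕ} (C : Submodule (ZMod 2) (Fin n → ZMod 2)) :
    Set (Fin n → ZMod 2) :=
  {c | c ∈ C ∧ c ≠ 0 ∧ ∃ (n1 n2 : Fin n → ZMod 2) (i : Fin n),
    IsCosetLeader C n1 ∧ IsCosetLeader C n2 ∧ n1 i = 0 ∧
    c = n1 + n2 + Pi.single i 1}

/-- The Voronoi region of a codeword `c` of `C`. -/
def voronoi {n : ℕ} (C : Submodule (ZMod 2) (Fin n → ZMod 2))
    (c : Fin n → ZMod 2) : Set (Fin n → ZMod 2) :=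
  {y | ∀ c' ∈ C, hammingDist y c ≤ hammingDist y c'}

/-- `X(A)`: the set of words at Hamming distance exactly 1 from `A`. -/
noncomputable def distOneSet {n : ℕ} (A : Set (Fin n → ZMod 2)) :
    Set (Fin n → ZMod 2) :=
  {y | sInf {d : ℕ | ∃ a ∈ A, hammingDist y a = d} = 1}

theorem ZMod.eq_one_of_ne_zero_two {a : ZMod 2} (h : a ≠ 0) : a = 1 := by
  revert a
  decide

theorem hammingNorm_add_single_of_eq_zero {n : ℕ} {w : Fin n → ZMod 2} {j : Fin n}
    (hj : w j = 0) : hammingNorm (w + Pi.single j 1) = hammingNorm w + 1 := by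
  have hset : Finset.univ.filter (fun k => (w + Pi.single j 1 : Fin n → ZMod 2) k ≠ 0)
      = insert j (Finset.univ.filter fun k => w k ≠ 0) := by
    ext k
    by_cases hk : k = j
    · subst hk
      simp [hj]
    · simp [hk]
  rw [hammingNorm, hammingNorm, hset, Finset.card_insert_of_notMem (by simp [hj])]

theorem add_single_add_single {n : ℕ} (w : Fin n → ZMod 2) (j : Fin n) :
    w + Pi.single j 1 + Pi.single j 1 = w := by
  rw [add_assoc, ZModModule.add_self, add_zero]

theorem hammingNorm_of_eq_one {n : ℕ} {w : Fin n → ZMod 2} {j : Fin n}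
    (hj : w j = 1) : hammingNorm w = hammingNorm (w + Pi.single j 1) + 1 := by
  have h : (w + Pi.single j 1 : Fin n → ZMod 2) j = 0 := by
    simp [hj, ZModModule.add_self]
  rw [← hammingNorm_add_single_of_eq_zero h, add_single_add_single]

theorem hammingNorm_add_single_le {n : ℕ} (v : Fin n → ZMod 2) (j : Fin n) :
    hammingNorm (v + Pi.single j 1) ≤ hammingNorm v + 1 := by
  by_cases hj : v j = 0
  · exact (hammingNorm_add_single_of_eq_zero hj).le
  · have := hammingNorm_of_eq_one (ZMod.eq_one_of_ne_zero_two hj)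
    lia

theorem eq_add_single_of_hammingDist_eq_one {n : ℕ} {y a : Fin n → ZMod 2}
    (h : hammingDist y a = 1) : ∃ i, y = a + Pi.single i 1 := by
  obtain ⟨i, hi⟩ := Finset.card_eq_one.mp h
  refine ⟨i, funext fun k => ?_⟩
  have hk : y k ≠ a k ↔ k = i := by simpa using Finset.ext_iff.mp hi k
  by_cases hki : k = i
  · have hne : y k - a k ≠ 0 := sub_ne_zero.mpr (hk.mpr hki)
    subst hki
    simpa using sub_eq_iff_eq_add'.mp (ZMod.eq_one_of_ne_zero_two hne)
  · simpa [hki] using mt hk.mp hki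

theorem hammingDist_add_single {n : ℕ} (a : Fin n → ZMod 2) (i : Fin n) :
    hammingDist (a + Pi.single i 1) a = 1 := by
  rw [hammingDist_eq_hammingNorm, neg_add_eq_sub, sub_add_cancel_left, ZModModule.neg_eq_self]
  simpa using hammingNorm_add_single_of_eq_zero (w := 0) (j := i) rfl

/-- Coset leaders are closed under removing an element from the support. -/
theorem IsCosetLeader.add_single {n : ℕ} {C : Submodule (ZMod 2) (Fin n → ZMod 2)}
    {w : Fin n → ZMod 2} (hw : IsCosetLeader C w) {j : Fin n} (hj : w j = 1) :
    IsCosetLeader C (w + Pi.single j 1) := by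
  intro v hv
  have hC : w - (v + Pi.single j 1) ∈ C := by
    rwa [ZModModule.sub_eq_add, add_comm v, ← add_assoc, ← ZModModule.sub_eq_add]
  have h₁ := hw _ hC
  have h₂ := hammingNorm_add_single_le v j
  have h₃ := hammingNorm_of_eq_one hj
  lia

theorem mem_voronoi_iff_isCosetLeader {n : ℕ} {C : Submodule (ZMod 2) (Fin n → ZMod 2)}
    {y z : Fin n → ZMod 2} (hz : z ∈ C) : y ∈ voronoi C z ↔ IsCosetLeader C (y - z) := by
  have hdist (c : Fin n → ZMod 2) : hammingDist y c = hammingNorm (y - c) := by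
    rw [hammingDist_comm, hammingDist_eq_hammingNorm, neg_add_eq_sub]
  simp only [voronoi, Set.mem_ofPred_eq, IsCosetLeader, hdist]
  constructor
  · intro h v hv
    have hC : y - v ∈ C := by
      convert C.add_mem hv hz using 1
      abel
    simpa using h (y - v) hC
  · intro h c hc
    exact h (y - c) (by simpa using C.sub_mem hc hz)

theorem mem_distOneSet_iff {n : ℕ} {A : Set (Fin n → ZMod 2)} {y : Fin n → ZMod 2} :
    y ∈ distOneSet A ↔ y ∉ A ∧ ∃ a ∈ A, hammingDist y a = 1 := by
  constructor
  · intro h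
    have hne := Nat.nonempty_of_sInf_eq_succ h
    have hmem := Nat.sInf_mem hne
    rw [show sInf _ = 1 from h] at hmem
    refine ⟨fun hy => ?_, hmem⟩
    have h₀ : sInf {d : ℕ | ∃ a ∈ A, hammingDist y a = d} ≤ 0 :=
      Nat.sInf_le ⟨y, hy, hammingDist_self y⟩
    rw [show sInf _ = 1 from h] at h₀
    lia
  · rintro ⟨hy, hA⟩
    refine le_antisymm (Nat.sInf_le hA) (le_csInf (Set.nonempty_of_mem hA) ?_)
    rintro d ⟨a, ha, rfl⟩
    refine hammingDist_pos.mpr ?_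
    rintro rfl
    exact hy ha

theorem exists_eq_one_and_eq_zero {n : ℕ} {u v : Fin n → ZMod 2} (huv : u ≠ v)
    (hle : hammingNorm u ≤ hammingNorm v) : ∃ j, v j = 1 ∧ u j = 0 := by
  by_contra! h
  have hsub : (Finset.univ.filter fun k => v k ≠ 0) ⊆ Finset.univ.filter fun k => u k ≠ 0 := by
    intro k hk
    simpa using h k (ZMod.eq_one_of_ne_zero_two (by simpa using hk))
  have heq := Finset.eq_of_subset_of_card_le hsub hle
  refine huv (funext fun k => ?_)
  have hk : v k ≠ 0 ↔ u k ≠ 0 := by simpa using Finset.ext_iff.mp heq k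
  by_cases hv : v k = 0
  · rw [hv, not_ne_iff.mp (mt hk.mpr (not_ne_iff.mpr hv))]
  · rw [ZMod.eq_one_of_ne_zero_two hv, ZMod.eq_one_of_ne_zero_two (hk.mp hv)]

theorem stmt_10 {n : ℕ} (C : Submodule (ZMod 2) (Fin n → ZMod 2))
    (z : Fin n → ZMod 2) (hzC : z ∈ C) (hz0 : z ≠ 0) :
    (distOneSet (voronoi C 0) ∩ voronoi C z).Nonempty ↔ z ∈ leaderCodewords C := by
  have hzero (y) : y ∈ voronoi C 0 ↔ IsCosetLeader C y := by
    rw [mem_voronoi_iff_isCosetLeader C.zero_mem, sub_zero]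
  constructor
  · rintro ⟨y, hy, hyz⟩
    rw [mem_distOneSet_iff, hzero] at hy
    rw [mem_voronoi_iff_isCosetLeader hzC] at hyz
    obtain ⟨hy, a, ha, hd⟩ := hy
    rw [hzero] at ha
    obtain ⟨i, rfl⟩ := eq_add_single_of_hammingDist_eq_one hd
    refine ⟨hzC, hz0, a, _, i, ha, hyz, ?_, ?_⟩
    · by_contra hai
      exact hy (ha.add_single (ZMod.eq_one_of_ne_zero_two hai))
    · calc
        z = (a + a) + (Pi.single i 1 + Pi.single i 1) + z := by
          simp [ZModModule.add_self]
        _ = a + (a + Pi.single i 1 - z) + Pi.single i 1 := by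
          rw [ZModModule.sub_eq_add]
          abel
  · rintro ⟨-, -, n1, n2, i, h1, h2, hi, hz⟩
    obtain ⟨u, hu⟩ : ∃ u, u = n1 + Pi.single i 1 := ⟨_, rfl⟩
    have hzu : z = u + n2 := by
      rw [hz, hu]
      abel
    by_cases hlead : IsCosetLeader C u
    · have huv : u ≠ n2 := by
        rintro rfl
        exact hz0 (by rw [hzu, ZModModule.add_self])
      have hle : hammingNorm u ≤ hammingNorm n2 :=
        hlead n2 (by rwa [ZModModule.sub_eq_add, ← hzu])
      have hge : hammingNorm n2 ≤ hammingNorm u :=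
        h2 u (by rwa [ZModModule.sub_eq_add, add_comm, ← hzu])
      obtain ⟨j, hj, huj⟩ := exists_eq_one_and_eq_zero huv hle
      have hsub : u + Pi.single j 1 - z = n2 + Pi.single j 1 := by
        calc
          _ = (u + u) + (n2 + Pi.single j 1) := by
            rw [ZModModule.sub_eq_add, hzu]
            abel
          _ = _ := by rw [ZModModule.add_self, zero_add]
      refine ⟨u + Pi.single j 1, mem_distOneSet_iff.mpr
        ⟨fun hy => ?_, u, (hzero u).mpr hlead, hammingDist_add_single u j⟩, ?_⟩
      · have hlt := (hzero _).mp hy (n2 + Pi.single j 1) (by rw [← hsub]; simpa using hzC)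
        have := hammingNorm_add_single_of_eq_zero huj
        have := hammingNorm_of_eq_one hj
        lia
      · rw [mem_voronoi_iff_isCosetLeader hzC, hsub]
        exact h2.add_single hj
    · refine ⟨u, mem_distOneSet_iff.mpr ⟨mt (hzero u).mp hlead, n1, (hzero n1).mpr h1, ?_⟩, ?_⟩
      · rw [hu]
        exact hammingDist_add_single n1 i
      · rw [mem_voronoi_iff_isCosetLeader hzC, hzu, ZModModule.sub_eq_add, ← add_assoc,
          ZModModule.add_self, zero_add]
        exact h2
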